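/- Let ν be a finite positive Borel measure on 𝕋 singular with respect to m and let θ = S_ν be the corresponding singular inner function, θ(z) = exp(−∫_𝕋 (x+z)/(x−z) dν(x)). Let H² be the Hilbert space of analytic functions f(z) = ∑_{n≥0} f_n zⁿ on 𝔻 with ‖f‖² = ∑_{n≥0} |f_n|² < ∞, and define the model space K_θ = {f ∈ H² : for every analytic polynomial p, ∑_{n≥0} (θp)_n · conj(f_n) = 0}, where (θp)_n denotes the n-th Taylor coefficient of θ·p. If f ∈ K_θ satisfies sup_{n≥0} |f_n|·exp(c√n) < ∞ for some c > 0, then f = 0. -/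

import Mathlib

open MeasureTheory Complex Set Filter Metric
open scoped Real ENNReal Topology

noncomputable section

/-- Normalized arc-length measure on the unit circle (so that m(𝕋) = 1). -/
def mT : Measure ℂ :=
  Measure.map (fun θ : ℝ => Complex.exp (θ * Complex.I))
    ((ENNReal.ofReal (2 * Real.pi))⁻¹ • volume.restrict (Set.Ioc 0 (2 * Real.pi)))

/-- The unit circle 𝕋 as a subset of ℂ. -/
def unitCircle : Set ℂ := Metric.sphere (0:ℂ) 1

/-- Singular inner function associated to the measure ν:
θ(z) = exp(-∫ (x+z)/(x-z) dν(x)). -/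
def Sinner (ν : Measure ℂ) (z : ℂ) : ℂ := Complex.exp (-∫ x, (x + z) / (x - z) ∂ν)

/-- Taylor coefficient at the origin of an analytic function on 𝔻. -/
def taylorCoeff (f : ℂ → ℂ) (n : ℕ) : ℂ := iteratedDeriv n f 0 / (n.factorial : ℂ)

/-- Cauchy's estimate for Taylor coefficients. -/
lemma norm_taylorCoeff_le {g : ℂ → ℂ} (hg : DifferentiableOn ℂ g (ball 0 1)) {R M : ℝ}
    (hR0 : 0 < R) (hR1 : R < 1) (hM : ∀ z ∈ sphere (0 : ℂ) R, ‖g z‖ ≤ M) (n : ℕ) :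
    ‖taylorCoeff g n‖ ≤ M / R ^ n := by
  have hd : DiffContOnCl ℂ g (ball 0 R) := by
    apply DifferentiableOn.diffContOnCl
    rw [closure_ball _ hR0.ne']
    exact hg.mono (closedBall_subset_ball hR1)
  have h := norm_iteratedDeriv_le_of_forall_mem_sphere_norm_le n hR0 hd hM
  have hn : (0 : ℝ) < n.factorial := by positivity
  rw [taylorCoeff, norm_div, Complex.norm_natCast, div_le_iff₀ hn]
  calc _ ≤ _ := h
    _ = _ := by ring

lemma taylorCoeff_sub {g h : ℂ → ℂ} (hg : DifferentiableOn ℂ g (ball 0 1))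
    (hh : DifferentiableOn ℂ h (ball 0 1)) (n : ℕ) :
    taylorCoeff (g - h) n = taylorCoeff g n - taylorCoeff h n := by
  have h0 : ball (0 : ℂ) 1 ∈ 𝓝 0 := ball_mem_nhds _ one_pos
  rw [taylorCoeff, iteratedDeriv_sub (hg.analyticAt h0).contDiffAt (hh.analyticAt h0).contDiffAt,
    sub_div, taylorCoeff, taylorCoeff]

lemma tendsto_taylorCoeff {G : ℕ → ℂ → ℂ} {g : ℂ → ℂ}
    (hG : ∀ k, DifferentiableOn ℂ (G k) (ball 0 1)) (hg : DifferentiableOn ℂ g (ball 0 1))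
    (hconv : TendstoUniformlyOn G g atTop (sphere 0 (1 / 2))) (n : ℕ) :
    Tendsto (fun k => taylorCoeff (G k) n) atTop (𝓝 (taylorCoeff g n)) := by
  rw [Metric.tendsto_atTop]
  intro ε hε
  have hε' : 0 < ε / 2 * (1 / 2) ^ n := by positivity
  obtain ⟨N, hN⟩ := eventually_atTop.1 (Metric.tendstoUniformlyOn_iff.1 hconv _ hε')
  refine ⟨N, fun k hk => ?_⟩
  have h1 := norm_taylorCoeff_le ((hG k).sub hg) (R := 1 / 2) (M := ε / 2 * (1 / 2) ^ n)
    (by norm_num) (by norm_num)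
    (fun z hz => by
      have := (hN k hk z hz).le
      rwa [dist_comm, dist_eq_norm] at this) n
  rw [taylorCoeff_sub (hG k) hg, mul_div_assoc, div_self (by positivity), mul_one] at h1
  rw [dist_eq_norm]
  linarith

/-- A function on the disk of growth `exp (b / (1 - |z|))` with small `b` has Taylor
coefficients of growth `exp (c √n)` with small `c`. -/
lemma exists_norm_taylorCoeff_le {c : ℝ} (hc : 0 < c) :
    ∃ b > 0, ∀ (A : ℝ) (g : ℂ → ℂ), 0 ≤ A → DifferentiableOn ℂ g (ball 0 1) →
      (∀ z ∈ ball (0 : ℂ) 1, ‖g z‖ ≤ A * Real.exp (b / (1 - ‖z‖))) →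
      ∀ n : ℕ, ‖taylorCoeff g n‖ ≤ A * Real.exp (c * (√n + 1)) := by
  set ε : ℝ := min (1 / 2) (c / 4) with hε
  have hε0 : 0 < ε := by positivity
  have hε1 : ε ≤ 1 / 2 := min_le_left _ _
  have hε2 : ε ≤ c / 4 := min_le_right _ _
  refine ⟨ε * (c / 2), by positivity, fun A g hA hg hb n => ?_⟩
  set s : ℝ := √((n : ℝ) + 1) with hs
  have hss : s * s = n + 1 := Real.mul_self_sqrt (by positivity)
  have hs0 : 0 ≤ s := Real.sqrt_nonneg _
  have hs1 : 1 ≤ s := by nlinarith [(Nat.cast_nonneg n : (0 : ℝ) ≤ n)]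
  have hsn : s ≤ √n + 1 := by
    rw [hs]
    apply Real.sqrt_le_iff.2 ⟨by positivity, ?_⟩
    nlinarith [Real.sq_sqrt (Nat.cast_nonneg n : (0 : ℝ) ≤ n), Real.sqrt_nonneg (n : ℝ)]
  set δ : ℝ := ε / s with hδ
  have hδ0 : 0 < δ := by positivity
  have hδ1 : δ ≤ 1 / 2 := (div_le_self hε0.le hs1).trans hε1
  have hδs : δ * s = ε := div_mul_cancel₀ _ (by positivity)
  have h1 := norm_taylorCoeff_le hg (R := 1 - δ) (M := A * Real.exp (c / 2 * s))
    (by linarith) (by linarith) (fun z hz => by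
      rw [mem_sphere_zero_iff_norm] at hz
      have := hb z (by rw [mem_ball_zero_iff, hz]; linarith)
      rw [hz] at this
      convert this using 3
      rw [sub_sub_cancel, eq_div_iff hδ0.ne', ← hδs]
      ring) n
  have hinv : (1 - δ)⁻¹ ≤ Real.exp (2 * δ) := by
    rw [inv_le_comm₀ (by linarith) (Real.exp_pos _), ← Real.exp_neg]
    have h2 : 1 + 2 * δ ≤ Real.exp (2 * δ) := by linarith [Real.add_one_le_exp (2 * δ)]
    rw [Real.exp_neg]
    calc (Real.exp (2 * δ))⁻¹ ≤ (1 + 2 * δ)⁻¹ := by gcongr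
      _ ≤ 1 - δ := by
        rw [inv_le_iff_one_le_mul₀ (by linarith)]
        nlinarith
  have hpow : ((1 - δ) ^ n)⁻¹ ≤ Real.exp (c / 2 * s) := by
    rw [← inv_pow]
    calc ((1 - δ)⁻¹) ^ n ≤ Real.exp (2 * δ) ^ n := by
          gcongr
          exact inv_nonneg.2 (by linarith)
      _ = Real.exp (n * (2 * δ)) := (Real.exp_nat_mul _ _).symm
      _ ≤ Real.exp (c / 2 * s) := by
        apply Real.exp_le_exp.2
        have : (n : ℝ) ≤ s * s := by linarith
        calc (n : ℝ) * (2 * δ) ≤ (s * s) * (2 * δ) := by gcongr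
          _ = 2 * ε * s := by rw [← hδs]; ring
          _ ≤ c / 2 * s := by gcongr; linarith
  calc ‖taylorCoeff g n‖ ≤ A * Real.exp (c / 2 * s) * ((1 - δ) ^ n)⁻¹ := by
        rwa [div_eq_mul_inv] at h1
    _ ≤ A * Real.exp (c / 2 * s) * Real.exp (c / 2 * s) := by gcongr
    _ = A * Real.exp (c * s) := by rw [mul_assoc, ← Real.exp_add]; ring_nf
    _ ≤ A * Real.exp (c * (√n + 1)) := by gcongr

lemma summable_exp_neg_mul_sqrt {c : ℝ} (hc : 0 < c) :
    Summable (fun n : ℕ => Real.exp (-(c * √n))) := by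
  have hs : Summable (fun n : ℕ => (24 / c ^ 4) * (1 / (n : ℝ) ^ 2)) :=
    (Real.summable_one_div_nat_pow.2 one_lt_two).mul_left _
  refine hs.of_norm_bounded_eventually_nat ?_
  filter_upwards [eventually_gt_atTop 0] with n hn
  have hn' : (0 : ℝ) < n := by exact_mod_cast hn
  have h := Real.pow_div_factorial_le_exp (c * √n) (by positivity) 4
  have h4 : (√(n : ℝ)) ^ 4 = (n : ℝ) ^ 2 := by
    rw [show 4 = 2 * 2 by norm_num, pow_mul, Real.sq_sqrt hn'.le]
  rw [mul_pow, h4] at h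
  rw [Real.norm_of_nonneg (Real.exp_nonneg _), Real.exp_neg]
  calc (Real.exp (c * √n))⁻¹ ≤ (c ^ 4 * (n : ℝ) ^ 2 / (Nat.factorial 4 : ℕ))⁻¹ := by gcongr
    _ = _ := by
      simp only [Nat.factorial]
      push_cast
      field_simp

/-- The pairing `g ↦ ∑ gₙ conj(fₙ)` with a rapidly decaying sequence `f`. -/
def coeffPairing (f : ℕ → ℂ) (g : ℂ → ℂ) : ℂ :=
  ∑' n : ℕ, taylorCoeff g n * (starRingEnd ℂ) (f n)

/-- The pairing with a rapidly decaying sequence is sequentially continuous under uniform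
convergence on a circle and a growth bound `exp (b / (1 - |z|))` with small `b`. -/
lemma exists_tendsto_coeffPairing {f : ℕ → ℂ} {c C : ℝ} (hc : 0 < c)
    (hf : ∀ n : ℕ, ‖f n‖ * Real.exp (c * √n) ≤ C) :
    ∃ b > 0, ∀ (A : ℝ) (G : ℕ → ℂ → ℂ) (g : ℂ → ℂ), 0 ≤ A →
      (∀ k, DifferentiableOn ℂ (G k) (ball 0 1)) → DifferentiableOn ℂ g (ball 0 1) →
      (∀ k, ∀ z ∈ ball (0 : ℂ) 1, ‖G k z‖ ≤ A * Real.exp (b / (1 - ‖z‖))) →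
      TendstoUniformlyOn G g atTop (sphere 0 (1 / 2)) →
      Tendsto (fun k => coeffPairing f (G k)) atTop (𝓝 (coeffPairing f g)) := by
  obtain ⟨b, hb, hbc⟩ := exists_norm_taylorCoeff_le (half_pos hc)
  refine ⟨b, hb, fun A G g hA hG hg hbound hconv => ?_⟩
  refine tendsto_tsum_of_dominated_convergence
    (bound := fun n : ℕ => A * C * Real.exp (c / 2) * Real.exp (-(c / 2 * √n)))
    ((summable_exp_neg_mul_sqrt (half_pos hc)).mul_left _)
    (fun n => (tendsto_taylorCoeff hG hg hconv n).mul_const _)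
    (Eventually.of_forall fun k n => ?_)
  have hfn : ‖f n‖ ≤ C * Real.exp (-(c * √n)) := by
    rw [Real.exp_neg, ← div_eq_mul_inv, le_div_iff₀ (Real.exp_pos _)]
    exact hf n
  rw [norm_mul, RCLike.norm_conj]
  calc ‖taylorCoeff (G k) n‖ * ‖f n‖
      ≤ (A * Real.exp (c / 2 * (√n + 1))) * (C * Real.exp (-(c * √n))) := by
        gcongr
        exact hbc A (G k) hA (hG k) (hbound k) n
    _ = A * C * (Real.exp (c / 2 * (√n + 1)) * Real.exp (-(c * √n))) := by ring
    _ = A * C * (Real.exp (c / 2) * Real.exp (-(c / 2 * √n))) := by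
        rw [← Real.exp_add, ← Real.exp_add]; ring_nf
    _ = _ := by ring

/-- A function holomorphic on a disk of radius `R > 1` is a uniform limit of polynomials on the
unit disk. -/
lemma exists_polynomial_tendstoUniformlyOn {h : ℂ → ℂ} {R : ℝ} (hR : 1 < R)
    (hh : DifferentiableOn ℂ h (ball 0 R)) :
    ∃ P : ℕ → Polynomial ℂ,
      TendstoUniformlyOn (fun k z => (P k).eval z) h atTop (ball 0 1) := by
  obtain ⟨r, hr1, hrR⟩ := exists_between hR
  have hr0 : 0 < r := by linarith
  lift r to NNReal using hr0.le
  have hfp := DifferentiableOn.hasFPowerSeriesOnBall (R := r) (c := (0 : ℂ))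
    (hh.mono (closedBall_subset_ball hrR)) (by exact_mod_cast hr0)
  have := hfp.tendstoUniformlyOn' (r' := 1) (by
    exact_mod_cast hr1)
  set q := cauchyPowerSeries h 0 r
  refine ⟨fun k => ∑ i ∈ Finset.range k, Polynomial.monomial i (q.coeff i), ?_⟩
  refine this.congr (Eventually.of_forall fun k z _ => ?_)
  simp only [sub_zero, FormalMultilinearSeries.partialSum, Polynomial.eval_finsetSum,
    Polynomial.eval_monomial]
  refine Finset.sum_congr rfl fun i _ => ?_
  rw [FormalMultilinearSeries.apply_eq_pow_smul_coeff, smul_eq_mul, mul_comm]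

lemma exists_norm_polynomial_eval_le (p : Polynomial ℂ) :
    ∃ M : ℝ, 0 ≤ M ∧ ∀ z ∈ ball (0 : ℂ) 1, ‖p.eval z‖ ≤ M := by
  obtain ⟨M, hM⟩ := (isCompact_closedBall (0 : ℂ) 1).exists_bound_of_continuousOn
    p.continuous.continuousOn
  exact ⟨M, (norm_nonneg _).trans (hM 0 (by simp)),
    fun z hz => hM z (ball_subset_closedBall hz)⟩

/-- If the pairing annihilates all polynomial multiples of a bounded function `F`, it annihilates
all multiples of `F` by functions holomorphic on a larger disk. -/
lemma coeffPairing_mul_eq_zero {f : ℕ → ℂ} {c C : ℝ} (hc : 0 < c)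
    (hf : ∀ n : ℕ, ‖f n‖ * Real.exp (c * √n) ≤ C) {F : ℂ → ℂ}
    (hF : DifferentiableOn ℂ F (ball 0 1)) (hF1 : ∀ z ∈ ball (0 : ℂ) 1, ‖F z‖ ≤ 1)
    (hp : ∀ p : Polynomial ℂ, coeffPairing f (fun z => F z * p.eval z) = 0)
    {h : ℂ → ℂ} {R : ℝ} (hR : 1 < R) (hh : DifferentiableOn ℂ h (ball 0 R)) :
    coeffPairing f (fun z => F z * h z) = 0 := by
  obtain ⟨b, hb, H⟩ := exists_tendsto_coeffPairing hc hf
  obtain ⟨P, hP⟩ := exists_polynomial_tendstoUniformlyOn hR hh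
  obtain ⟨M, hM⟩ := (isCompact_closedBall (0 : ℂ) 1).exists_bound_of_continuousOn
    (hh.continuousOn.mono (closedBall_subset_ball hR))
  have hM0 : 0 ≤ M := (norm_nonneg _).trans (hM 0 (by simp))
  obtain ⟨N, hN⟩ := eventually_atTop.1 (Metric.tendstoUniformlyOn_iff.1 hP 1 one_pos)
  have key := H (M + 1) (fun k z => F z * (P (k + N)).eval z) (fun z => F z * h z)
    (by positivity) (fun k => hF.mul (P (k + N)).differentiable.differentiableOn)
    (hF.mul (hh.mono (ball_subset_ball hR.le)))
    (fun k z hz => by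
      have hz1 : ‖z‖ < 1 := by simpa using hz
      have h1 := hN (k + N) (by lia) z hz
      have h2 := hM z (ball_subset_closedBall hz)
      rw [dist_comm, dist_eq_norm] at h1
      have h3 : ‖(P (k + N)).eval z‖ ≤ M + 1 := by
        have := norm_add_le ((P (k + N)).eval z - h z) (h z)
        rw [sub_add_cancel] at this
        linarith
      have h4 : 1 ≤ Real.exp (b / (1 - ‖z‖)) :=
        Real.one_le_exp (div_nonneg hb.le (by linarith))
      calc ‖F z * (P (k + N)).eval z‖ = ‖F z‖ * ‖(P (k + N)).eval z‖ := norm_mul _ _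
        _ ≤ 1 * (M + 1) := by gcongr; exact hF1 z hz
        _ = (M + 1) * 1 := by ring
        _ ≤ _ := by gcongr)
    (by
      rw [Metric.tendstoUniformlyOn_iff]
      intro ε hε
      obtain ⟨N', hN'⟩ := eventually_atTop.1 (Metric.tendstoUniformlyOn_iff.1 hP ε hε)
      filter_upwards [eventually_ge_atTop N'] with k hk z hz
      have hz1 : z ∈ ball (0 : ℂ) 1 := by
        rw [mem_sphere_zero_iff_norm] at hz
        rw [mem_ball_zero_iff, hz]; norm_num
      have h1 := hN' (k + N) (by lia) z hz1
      rw [dist_eq_norm] at h1 ⊢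
      rw [← mul_sub, norm_mul]
      calc ‖F z‖ * ‖h z - (P (k + N)).eval z‖ ≤ 1 * ‖h z - (P (k + N)).eval z‖ := by
            gcongr; exact hF1 z hz1
        _ < ε := by rwa [one_mul])
  simp only [hp] at key
  exact (tendsto_nhds_unique key tendsto_const_nhds)

lemma tendstoUniformlyOn_dilation {u : ℂ → ℂ} (hu : ContinuousOn u (ball 0 1)) {r : ℕ → ℝ}
    (hr0 : ∀ k, 0 < r k) (hr1 : ∀ k, r k < 1) (hr : Tendsto r atTop (𝓝 1)) :
    TendstoUniformlyOn (fun k z => u (r k * z)) u atTop (sphere 0 (1 / 2)) := by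
  have huc := (isCompact_closedBall (0 : ℂ) (1 / 2)).uniformContinuousOn_of_continuous
    (hu.mono (closedBall_subset_ball (by norm_num)))
  rw [Metric.tendstoUniformlyOn_iff]
  intro ε hε
  obtain ⟨δ, hδ, H⟩ := Metric.uniformContinuousOn_iff.1 huc ε hε
  obtain ⟨N, hN⟩ := Metric.tendsto_atTop.1 hr δ hδ
  filter_upwards [eventually_ge_atTop N] with k hk z hz
  rw [mem_sphere_zero_iff_norm] at hz
  have hk' := hN k hk
  rw [Real.dist_eq, abs_sub_comm, abs_of_pos (by linarith [hr1 k])] at hk'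
  have hnorm : ‖(r k : ℂ) * z‖ = r k * (1 / 2) := by
    rw [norm_mul, hz, Complex.norm_real, Real.norm_of_nonneg (hr0 k).le]
  refine H z (by rw [mem_closedBall_zero_iff, hz]) _
    (by rw [mem_closedBall_zero_iff, hnorm]; linarith [hr1 k]) ?_
  have : z - r k * z = ((1 - r k : ℝ) : ℂ) * z := by push_cast; ring
  rw [dist_eq_norm, this, norm_mul, hz, Complex.norm_real,
    Real.norm_of_nonneg (by linarith [hr1 k])]
  linarith [hr1 k]

/-- One division step: a small power of the singular inner function can be cancelled. -/
lemma exists_coeffPairing_step {f : ℕ → ℂ} {c C : ℝ} (hc : 0 < c)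
    (hf : ∀ n : ℕ, ‖f n‖ * Real.exp (c * √n) ≤ C) {H : ℂ → ℂ} {B : ℝ}
    (hH : DifferentiableOn ℂ H (ball 0 1)) (hre : ∀ z ∈ ball (0 : ℂ) 1, 0 ≤ (H z).re)
    (hreB : ∀ z ∈ ball (0 : ℂ) 1, (H z).re ≤ B / (1 - ‖z‖)) :
    ∃ b > 0, ∀ s τ : ℝ, 0 ≤ s → 0 ≤ τ → s * B ≤ b →
      (∀ p : Polynomial ℂ, coeffPairing f (fun z => cexp (-(τ * H z)) * p.eval z) = 0) →
      ∀ p : Polynomial ℂ,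
        coeffPairing f (fun z => cexp (-((τ - s : ℝ) * H z)) * p.eval z) = 0 := by
  obtain ⟨b, hb, hlim⟩ := exists_tendsto_coeffPairing hc hf
  refine ⟨b, hb, fun s τ hs hτ hsB hp p => ?_⟩
  have hdiff (t : ℝ) : DifferentiableOn ℂ (fun z => cexp (-(t * H z))) (ball 0 1) :=
    (hH.const_mul _).neg.cexp
  have hE1 : ∀ z ∈ ball (0 : ℂ) 1, ‖cexp (-(τ * H z))‖ ≤ 1 := fun z hz => by
    rw [Complex.norm_exp, Real.exp_le_one_iff]
    simpa using mul_nonneg hτ (hre z hz)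
  obtain ⟨M, hM0, hM⟩ := exists_norm_polynomial_eval_le p
  set r : ℕ → ℝ := fun k => 1 - 1 / ((k : ℝ) + 1 + 1) with hrdef
  have hr0 (k) : 0 < r k := by
    have : 1 / ((k : ℝ) + 1 + 1) < 1 := by
      rw [div_lt_one (by positivity)]; linarith [(Nat.cast_nonneg k : (0 : ℝ) ≤ k)]
    simp only [hrdef]; linarith
  have hr1 (k) : r k < 1 := by
    have : 0 < 1 / ((k : ℝ) + 1 + 1) := by positivity
    simp only [hrdef]; linarith
  have hr : Tendsto r atTop (𝓝 1) := by
    have h1 : Tendsto (fun k : ℕ => 1 / ((k : ℝ) + 1 + 1)) atTop (𝓝 0) := by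
      have := (tendsto_add_atTop_iff_nat 1).2 (tendsto_one_div_add_atTop_nhds_zero_nat (𝕜 := ℝ))
      simpa using this
    have := h1.const_sub 1
    rwa [sub_zero] at this
  set u : ℂ → ℂ := fun z => cexp (-((-s : ℝ) * H z)) with hu
  have hmaps (k) : MapsTo (fun z : ℂ => (r k : ℂ) * z) (ball 0 (r k)⁻¹) (ball 0 1) :=
    fun z hz => by
      rw [mem_ball_zero_iff] at hz ⊢
      rw [norm_mul, Complex.norm_real, Real.norm_of_nonneg (hr0 k).le]
      calc r k * ‖z‖ < r k * (r k)⁻¹ := by gcongr; exact hr0 k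
        _ = 1 := mul_inv_cancel₀ (hr0 k).ne'
  have hR (k) : 1 < (r k)⁻¹ := (one_lt_inv₀ (hr0 k)).2 (hr1 k)
  have hudiff (k) : DifferentiableOn ℂ (fun z => u (r k * z)) (ball 0 (r k)⁻¹) :=
    (hdiff (-s)).comp (differentiableOn_id.const_mul _) (hmaps k)
  have hzero (k) : coeffPairing f (fun z => cexp (-(τ * H z)) * (u (r k * z) * p.eval z)) = 0 :=
    coeffPairing_mul_eq_zero hc hf (hdiff τ) hE1 hp (hR k)
      ((hudiff k).mul p.differentiable.differentiableOn)
  have key := hlim M (fun k z => cexp (-(τ * H z)) * (u (r k * z) * p.eval z))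
    (fun z => cexp (-((τ - s : ℝ) * H z)) * p.eval z) hM0
    (fun k => (hdiff τ).mul (((hudiff k).mono (ball_subset_ball (hR k).le)).mul
      p.differentiable.differentiableOn))
    ((hdiff _).mul p.differentiable.differentiableOn)
    (fun k z hz => by
      have hz1 : ‖z‖ < 1 := by simpa using hz
      have hn : ‖(r k : ℂ) * z‖ = r k * ‖z‖ := by
        rw [norm_mul, Complex.norm_real, Real.norm_of_nonneg (hr0 k).le]
      have hle : r k * ‖z‖ ≤ ‖z‖ := mul_le_of_le_one_left (norm_nonneg _) (hr1 k).le
      have h1 : ‖u (r k * z)‖ ≤ Real.exp (b / (1 - ‖z‖)) := by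
        rw [hu, Complex.norm_exp]
        gcongr
        have h2 := hreB (r k * z) (by rw [mem_ball_zero_iff, hn]; linarith)
        rw [hn] at h2
        calc (-((-s : ℝ) * H (r k * z))).re = s * (H (r k * z)).re := by simp
          _ ≤ s * (B / (1 - r k * ‖z‖)) := by gcongr
          _ = s * B / (1 - r k * ‖z‖) := by ring
          _ ≤ b / (1 - ‖z‖) := by gcongr
      calc ‖cexp (-(τ * H z)) * (u (r k * z) * p.eval z)‖
          = ‖cexp (-(τ * H z))‖ * (‖u (r k * z)‖ * ‖p.eval z‖) := by rw [norm_mul, norm_mul]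
        _ ≤ 1 * (Real.exp (b / (1 - ‖z‖)) * M) := by
          gcongr
          · exact hE1 z hz
          · exact hM z hz
        _ = _ := by ring)
    (by
      have hd := tendstoUniformlyOn_dilation (hdiff (-s)).continuousOn hr0 hr1 hr
      rw [Metric.tendstoUniformlyOn_iff] at hd ⊢
      intro ε hε
      filter_upwards [hd (ε / (M + 1)) (by positivity)] with k hk z hz
      have hz1 : z ∈ ball (0 : ℂ) 1 := by
        rw [mem_sphere_zero_iff_norm] at hz
        rw [mem_ball_zero_iff, hz]; norm_num
      have hkz := hk z hz
      have hsplit : cexp (-((τ - s : ℝ) * H z)) = cexp (-(τ * H z)) * u z := by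
        rw [hu, ← Complex.exp_add]; congr 1; push_cast; ring
      rw [dist_eq_norm] at hkz ⊢
      have heq : cexp (-((τ - s : ℝ) * H z)) * p.eval z
          - cexp (-(τ * H z)) * (u (r k * z) * p.eval z)
          = cexp (-(τ * H z)) * ((u z - u (r k * z)) * p.eval z) := by rw [hsplit]; ring
      rw [heq, norm_mul, norm_mul]
      calc ‖cexp (-(τ * H z))‖ * (‖u z - u (r k * z)‖ * ‖p.eval z‖)
          ≤ 1 * (‖u z - u (r k * z)‖ * (M + 1)) := by
            gcongr
            · exact hE1 z hz1
            · linarith [hM z hz1]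
        _ < ε := by rw [one_mul]; exact (lt_div_iff₀ (by positivity)).1 hkz)
  simp only [hzero] at key
  exact (tendsto_nhds_unique key tendsto_const_nhds)

/-- The Herglotz integral of a measure on the unit circle. -/
def herglotzIntegral (ν : Measure ℂ) (z : ℂ) : ℂ := ∫ x, (x + z) / (x - z) ∂ν

lemma ae_norm_eq_one {ν : Measure ℂ} (hν : ν unitCircleᶜ = 0) : ∀ᵐ x ∂ν, ‖x‖ = 1 := by
  have : ∀ᵐ x ∂ν, x ∈ unitCircle := hν
  filter_upwards [this] with x hx
  simpa [unitCircle] using hx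

lemma norm_herglotzKernel_le {x z : ℂ} (hx : ‖x‖ = 1) (hz : ‖z‖ < 1) :
    ‖(x + z) / (x - z)‖ ≤ 2 / (1 - ‖z‖) := by
  rw [norm_div]
  have h1 := norm_add_le x z
  have h2 := norm_sub_norm_le x z
  have h3 : 0 < 1 - ‖z‖ := by linarith
  gcongr <;> linarith

lemma aestronglyMeasurable_herglotzKernel {ν : Measure ℂ} (z : ℂ) :
    AEStronglyMeasurable (fun x : ℂ => (x + z) / (x - z)) ν :=
  Measurable.aestronglyMeasurable (by fun_prop)

lemma integrable_herglotzKernel {ν : Measure ℂ} [IsFiniteMeasure ν]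
    (hν : ν unitCircleᶜ = 0) {z : ℂ} (hz : ‖z‖ < 1) :
    Integrable (fun x : ℂ => (x + z) / (x - z)) ν :=
  .of_bound (aestronglyMeasurable_herglotzKernel z) (2 / (1 - ‖z‖))
    ((ae_norm_eq_one hν).mono fun _ hx => norm_herglotzKernel_le hx hz)

lemma differentiableOn_herglotzIntegral {ν : Measure ℂ} [IsFiniteMeasure ν]
    (hν : ν unitCircleᶜ = 0) :
    DifferentiableOn ℂ (herglotzIntegral ν) (ball 0 1) := by
  intro w hw
  rw [mem_ball_zero_iff] at hw
  obtain ⟨ρ, hwρ, hρ⟩ := exists_between hw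
  have hs : ball (0 : ℂ) ρ ∈ 𝓝 w := isOpen_ball.mem_nhds (by simpa using hwρ)
  have hne {x z : ℂ} (hx : ‖x‖ = 1) (hz : z ∈ ball (0 : ℂ) ρ) : 1 - ρ ≤ ‖x - z‖ := by
    rw [mem_ball_zero_iff] at hz
    linarith [norm_sub_norm_le x z]
  have := hasDerivAt_integral_of_dominated_loc_of_deriv_le (μ := ν) (x₀ := w) hs
    (F := fun z x : ℂ => (x + z) / (x - z)) (F' := fun z x => 2 * x / (x - z) ^ 2)
    (bound := fun _ => 2 / (1 - ρ) ^ 2)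
    (Eventually.of_forall fun z => aestronglyMeasurable_herglotzKernel z)
    (integrable_herglotzKernel hν hw)
    (Measurable.aestronglyMeasurable (by fun_prop))
    (by
      filter_upwards [ae_norm_eq_one hν] with x hx z hz
      have h1 := hne hx hz
      have h2 : 0 < 1 - ρ := by linarith
      rw [norm_div, norm_mul, hx, norm_pow]
      simp only [RCLike.norm_ofNat, mul_one]
      gcongr)
    (integrable_const _)
    (by
      filter_upwards [ae_norm_eq_one hν] with x hx z hz
      have h1 := hne hx hz
      have h2 : x - z ≠ 0 := by
        rw [← norm_pos_iff]; linarith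
      refine (((hasDerivAt_id' z).const_add x).fun_div
        ((hasDerivAt_id' z).const_sub x) h2).congr_deriv ?_
      ring)
  exact this.2.differentiableAt.differentiableWithinAt

lemma re_herglotzIntegral_nonneg {ν : Measure ℂ} [IsFiniteMeasure ν]
    (hν : ν unitCircleᶜ = 0) {z : ℂ} (hz : ‖z‖ < 1) :
    0 ≤ (herglotzIntegral ν z).re := by
  have h := integral_re (𝕜 := ℂ) (integrable_herglotzKernel hν hz)
  change _ = (herglotzIntegral ν z).re at h
  rw [← h]
  refine integral_nonneg_of_ae ?_
  filter_upwards [ae_norm_eq_one hν] with x hx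
  have hx2 : x.re * x.re + x.im * x.im = 1 := by
    rw [← Complex.normSq_apply, Complex.normSq_eq_norm_sq, hx]; norm_num
  have hz2 : z.re * z.re + z.im * z.im ≤ 1 := by
    rw [← Complex.normSq_apply, Complex.normSq_eq_norm_sq]
    nlinarith [norm_nonneg z]
  change 0 ≤ ((x + z) / (x - z)).re
  rw [Complex.div_re, ← add_div]
  refine div_nonneg ?_ (Complex.normSq_nonneg _)
  simp only [Complex.add_re, Complex.sub_re, Complex.add_im, Complex.sub_im]
  nlinarith

lemma re_herglotzIntegral_le {ν : Measure ℂ} [IsFiniteMeasure ν]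
    (hν : ν unitCircleᶜ = 0) {z : ℂ} (hz : ‖z‖ < 1) :
    (herglotzIntegral ν z).re ≤ 2 * ν.real univ / (1 - ‖z‖) := by
  refine (Complex.re_le_norm _).trans ?_
  refine (norm_integral_le_of_norm_le_const
    ((ae_norm_eq_one hν).mono fun _ hx => norm_herglotzKernel_le hx hz)).trans_eq ?_
  ring

lemma coeffPairing_pow (f : ℕ → ℂ) (m : ℕ) :
    coeffPairing f (fun z => z ^ m) = (starRingEnd ℂ) (f m) := by
  have h (n : ℕ) : taylorCoeff (fun z => z ^ m) n = if n = m then 1 else 0 := by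
    rw [taylorCoeff, iteratedDeriv_fun_pow_zero]
    split_ifs with hnm
    · subst hnm
      exact div_self (by exact_mod_cast n.factorial_ne_zero)
    · simp
  simp [coeffPairing, h]


/-- No non-zero function of the model space K_θ of a singular inner function θ = S_ν
has rapid spectral decay. A function f ∈ H², given by its Taylor coefficients
(f n), lies in K_θ iff ∑ₙ (θp)ₙ conj(fₙ) = 0 for every analytic polynomial p. -/
theorem model_space_no_rapid_spectral_decay
    (ν : Measure ℂ) [IsFiniteMeasure ν] (hνcirc : ν unitCircleᶜ = 0)
    (hνsing : ν.MutuallySingular mT)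
    -- f ∈ H², given through its Taylor coefficients
    (f : ℕ → ℂ) (hf2 : Summable (fun n => ‖f n‖ ^ 2))
    -- f ∈ K_θ: f is orthogonal to θ·p for every analytic polynomial p
    (hfK : ∀ p : Polynomial ℂ,
      ∑' n : ℕ, taylorCoeff (fun z => Sinner ν z * p.eval z) n * (starRingEnd ℂ) (f n) = 0)
    -- rapid spectral decay
    (hRSD : ∃ c > (0:ℝ), ∃ C : ℝ, ∀ n : ℕ, ‖f n‖ * Real.exp (c * Real.sqrt n) ≤ C) :
    ∀ n, f n = 0 := by
  obtain ⟨c, hc, C, hf⟩ := hRSD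
  obtain ⟨b, hb, hstep⟩ := exists_coeffPairing_step hc hf (H := herglotzIntegral ν)
    (B := 2 * ν.real univ) (differentiableOn_herglotzIntegral hνcirc)
    (fun z hz => re_herglotzIntegral_nonneg hνcirc (by simpa using hz))
    (fun z hz => re_herglotzIntegral_le hνcirc (by simpa using hz))
  obtain ⟨N, hN⟩ := exists_nat_gt (2 * ν.real univ / b)
  have hN0 : (0 : ℝ) < N := lt_of_le_of_lt (by positivity) hN
  have hsmall : 1 / (N : ℝ) * (2 * ν.real univ) ≤ b := by
    rw [div_lt_iff₀ hb] at hN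
    rw [one_div, inv_mul_le_iff₀ hN0]
    exact hN.le
  have hdescend : ∀ j ≤ N, ∀ p : Polynomial ℂ, coeffPairing f
      (fun z => cexp (-((1 - j * (1 / (N : ℝ)) : ℝ) * herglotzIntegral ν z)) * p.eval z) = 0 := by
    intro j
    induction j with
    | zero =>
      intro _ p
      simpa [coeffPairing, Sinner, herglotzIntegral] using hfK p
    | succ j ih =>
      intro hj p
      have hτ : 0 ≤ 1 - j * (1 / (N : ℝ)) := by
        have : (j : ℝ) ≤ N := by exact_mod_cast (Nat.le_succ j).trans hj
        rw [mul_one_div, sub_nonneg, div_le_one hN0]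
        exact this
      have := hstep (1 / (N : ℝ)) _ (by positivity) hτ hsmall (ih (by lia)) p
      convert this using 6
      push_cast
      ring
  intro n
  have h := hdescend N le_rfl (Polynomial.X ^ n)
  rw [mul_one_div_cancel hN0.ne'] at h
  simpa [coeffPairing_pow] using h
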